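/- For every real number λ, every positive integer k and every positive integer n, Σ_{r=0}^{k} C(k+1, r) · (1)_{k+1−r,λ} · S_{r,λ}(n) = (n+1)_{k+1,λ} − (1)_{k+1,λ}. -/

import Mathlib

/-- The degenerate falling factorial `(x)_{n,λ} = x(x-λ)(x-2λ)⋯(x-(n-1)λ)`. -/
def dfact (lam x : ℝ) (n : ℕ) : ℝ := ∏ i ∈ Finset.range n, (x - i * lam)

/-- The degenerate rising factorial `⟨x⟩_{n,λ} = x(x+λ)(x+2λ)⋯(x+(n-1)λ)`. -/
def drise (lam x : ℝ) (n : ℕ) : ℝ := ∏ i ∈ Finset.range n, (x + i * lam)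

/-- `S_{k,λ}(n) = Σ_{j=1}^n (j)_{k,λ}`. -/
def Sdeg (lam : ℝ) (k n : ℕ) : ℝ := ∑ j ∈ Finset.Icc 1 n, dfact lam j k

theorem dfact_succ (lam x : ℝ) (n : ℕ) :
    dfact lam x (n + 1) = dfact lam x n * (x - n * lam) :=
  Finset.prod_range_succ _ _

theorem dfact_add (lam x y : ℝ) (n : ℕ) :
    dfact lam (x + y) n =
      ∑ ij ∈ Finset.HasAntidiagonal.antidiagonal n, (n.choose ij.1 : ℝ) * (dfact lam x ij.1 * dfact lam y ij.2) := by
  induction n with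
  | zero => simp [dfact]
  | succ n ih =>
    rw [Finset.sum_antidiagonal_choose_succ_mul (fun i j => dfact lam x i * dfact lam y j),
      dfact_succ, ih, Finset.sum_mul, ← Finset.sum_add_distrib]
    refine Finset.sum_congr rfl fun ij hij => ?_
    obtain ⟨i, j⟩ := ij
    obtain rfl : i + j = n := Finset.HasAntidiagonal.mem_antidiagonal.mp hij
    have hsymm : (i + j).choose j = (i + j).choose i := Nat.choose_symm_add.symm
    simp only [dfact_succ, hsymm]
    push_cast
    ring

theorem dfact_add_one_sub (lam x : ℝ) (k : ℕ) :
    ∑ r ∈ Finset.range (k + 1),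
        ((k + 1).choose r : ℝ) * dfact lam 1 (k + 1 - r) * dfact lam x r =
      dfact lam (x + 1) (k + 1) - dfact lam x (k + 1) := by
  rw [dfact_add, Finset.Nat.sum_antidiagonal_eq_sum_range_succ_mk, Finset.sum_range_succ _ (k + 1)]
  have h0 : dfact lam 1 0 = 1 := by simp [dfact]
  simp only [Nat.choose_self, Nat.sub_self, h0, Nat.cast_one, one_mul, mul_one, add_sub_cancel_right]
  exact Finset.sum_congr rfl fun r _ => by ring

theorem stmt_8 (lam : ℝ) (k n : ℕ) (hk : 0 < k) (hn : 0 < n) :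
    ∑ r ∈ Finset.range (k + 1),
        ((k + 1).choose r : ℝ) * dfact lam 1 (k + 1 - r) * Sdeg lam r n =
      dfact lam (n + 1) (k + 1) - dfact lam 1 (k + 1) := by
  simp only [Sdeg, Finset.mul_sum]
  rw [Finset.sum_comm]
  simp only [dfact_add_one_sub]
  induction n, hn using Nat.le_induction with
  | base => simp
  | succ n _ ih =>
    rw [Finset.sum_Icc_succ_top (by omega), ih]
    push_cast
    ring
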